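/- In the refining-subset FISTA setup, let 0 = n_0 < n_1 < n_2 < … be integers and for each k ≥ 0 let z̃_k be a point belonging to U^n for every n with n_k ≤ n < n_{k+1}. Suppose there are constants a_E ≥ 1, C_U > 0, C_E > 0 such that ‖z̃_k‖ ≤ C_U and E_0(z̃_k) ≤ C_E·a_E^{−k} for all k ≥ 0, and that Σ_{k=1}^∞ n_k²·a_E^{−k} < ∞ and Σ_{k=1}^∞ ‖z̃_k − z̃_{k+1}‖ < ∞. Then there exists C' > 0 such that t_N²·E_0(x_N) ≤ C' for all N ≥ 1. -/

import Mathlib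

open scoped RealInnerProductSpace

theorem aux_line {H : Type*} [NormedAddCommGroup H] [InnerProductSpace ℝ H] [CompleteSpace H]
    (f : H → ℝ) (f' : H → H) (hf' : ∀ u, HasGradientAt f (f' u) u) (a d : H) (s : ℝ) :
    HasDerivAt (fun s : ℝ => f (a + s • d)) (inner ℝ (f' (a + s • d)) d) s := by
  have h1 : HasDerivAt (fun s : ℝ => a + s • d) d s := by
    simpa using ((hasDerivAt_id s).smul_const d).const_add a
  have h2 := (hf' (a + s • d)).hasFDerivAt
  have h3 := h2.comp_hasDerivAt s h1
  simpa [Function.comp_def] using h3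

theorem aux_descent {H : Type*} [NormedAddCommGroup H] [InnerProductSpace ℝ H] [CompleteSpace H]
    (f : H → ℝ) (f' : H → H) (hf' : ∀ u, HasGradientAt f (f' u) u) (hl : LipschitzWith 1 f')
    (a d : H) : f (a + d) ≤ f a + inner ℝ (f' a) d + (1/2) * ‖d‖ ^ 2 := by
  have hd : ∀ s : ℝ, HasDerivAt
      (fun s : ℝ => f (a + s • d) - s * inner ℝ (f' a) d - s ^ 2 * ((1/2) * ‖d‖ ^ 2))
      (inner ℝ (f' (a + s • d)) d - inner ℝ (f' a) d - s * ‖d‖ ^ 2) s := by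
    intro s
    have h1 := aux_line f f' hf' a d s
    have h2 := (hasDerivAt_id s).mul_const (inner ℝ (f' a) d)
    have h3 := ((hasDerivAt_id s).pow 2).mul_const ((1/2) * ‖d‖ ^ 2)
    have := (h1.sub h2).sub h3
    refine this.congr_deriv ?_
    simp only [id_eq, Nat.cast_ofNat]
    ring
  have ha : AntitoneOn
      (fun s : ℝ => f (a + s • d) - s * inner ℝ (f' a) d - s ^ 2 * ((1/2) * ‖d‖ ^ 2))
      (Set.Icc 0 1) := by
    apply antitoneOn_of_deriv_nonpos (convex_Icc 0 1)
    · exact fun s _ => (hd s).continuousAt.continuousWithinAt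
    · exact fun s _ => (hd s).differentiableAt.differentiableWithinAt
    · intro s hs
      rw [interior_Icc] at hs
      rw [(hd s).deriv]
      have h1 : inner ℝ (f' (a + s • d) - f' a) d ≤ ‖f' (a + s • d) - f' a‖ * ‖d‖ :=
        real_inner_le_norm _ _
      have h2 : ‖f' (a + s • d) - f' a‖ ≤ s * ‖d‖ := by
        have := hl.dist_le_mul (a + s • d) a
        rw [dist_eq_norm, dist_eq_norm] at this
        simpa [norm_smul, abs_of_pos hs.1] using this
      rw [inner_sub_left] at h1
      nlinarith [norm_nonneg d, mul_le_mul_of_nonneg_right h2 (norm_nonneg d)]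
  have := ha (Set.left_mem_Icc.2 zero_le_one) (Set.right_mem_Icc.2 zero_le_one) zero_le_one
  simp at this
  linarith

theorem aux_lim {A B : ℝ} (h : ∀ s : ℝ, 0 < s → s ≤ 1 → 0 ≤ s * A + s ^ 2 * B) : 0 ≤ A := by
  by_contra hA
  push Not at hA
  have hp : 0 < |B| + 1 - A := by have := abs_nonneg B; linarith
  have h1 := h (-A / (|B| + 1 - A)) (by apply div_pos <;> linarith)
    (by rw [div_le_one hp]; have := abs_nonneg B; linarith)
  set s := -A / (|B| + 1 - A) with hs
  have hs0 : 0 < s := by apply div_pos <;> linarith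
  have h2 : 0 ≤ A + s * B := by
    by_contra h3
    push Not at h3
    nlinarith
  have h3 : s * (|B| + 1 - A) = -A := by rw [hs]; field_simp
  nlinarith [le_abs_self B]

theorem aux_grad {H : Type*} [NormedAddCommGroup H] [InnerProductSpace ℝ H] [CompleteSpace H]
    (f : H → ℝ) (f' : H → H) (hc : ConvexOn ℝ Set.univ f)
    (hf' : ∀ u, HasGradientAt f (f' u) u) (hl : LipschitzWith 1 f')
    (a d : H) : f a + inner ℝ (f' a) d ≤ f (a + d) := by
  have hcl : ConvexOn ℝ Set.univ (fun s : ℝ => f (a + s • d)) := by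
    refine ⟨convex_univ, fun p _ q _ α β hα hβ hab => ?_⟩
    have := hc.2 (Set.mem_univ (a + p • d)) (Set.mem_univ (a + q • d)) hα hβ hab
    have e : α • (a + p • d) + β • (a + q • d) = a + (α • p + β • q) • d := by
      have : β = 1 - α := by linarith
      subst this
      simp only [smul_eq_mul]
      module
    rw [e] at this
    exact this
  have h := hcl.le_slope_of_hasDerivAt (Set.mem_univ (0:ℝ)) (Set.mem_univ (1:ℝ)) zero_lt_one
    (aux_line f f' hf' a d 0)
  simp [slope_def_field] at h
  linarith

theorem aux_prox {H : Type*} [NormedAddCommGroup H] [InnerProductSpace ℝ H] 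
    (g : H → ℝ) (hc : ConvexOn ℝ Set.univ g) (V : Set H) (hV : Convex ℝ V)
    (p w u : H) (hp : p ∈ V) (hu : u ∈ V)
    (hmin : ∀ v ∈ V, (1/2) * ‖p - w‖ ^ 2 + g p ≤ (1/2) * ‖v - w‖ ^ 2 + g v) :
    0 ≤ inner ℝ (p - w) (u - p) + g u - g p := by
  apply aux_lim (B := (1/2) * ‖u - p‖ ^ 2)
  intro s hs0 hs1
  have hm : (1 - s) • p + s • u ∈ V := hV hp hu (by linarith) hs0.le (by ring)
  have h1 := hmin _ hm
  have h2 := hc.2 (Set.mem_univ p) (Set.mem_univ u) (by linarith : 0 ≤ 1 - s) hs0.le (by ring)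
  simp only [smul_eq_mul] at h2
  have e : (1 - s) • p + s • u - w = (p - w) + s • (u - p) := by module
  rw [e, norm_add_sq_real, inner_smul_right, norm_smul, Real.norm_eq_abs, mul_pow, sq_abs] at h1
  linarith

theorem aux_step {H : Type*} [NormedAddCommGroup H] [InnerProductSpace ℝ H] [CompleteSpace H]
    (f g : H → ℝ) (f' : H → H)
    (hf : ConvexOn ℝ Set.univ f) (hg : ConvexOn ℝ Set.univ g)
    (hf' : ∀ u, HasGradientAt f (f' u) u) (hl : LipschitzWith 1 f')
    (V : Set H) (hV : Convex ℝ V) (p a u : H) (hp : p ∈ V) (hu : u ∈ V)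
    (hmin : ∀ v ∈ V, (1/2) * ‖p - a + f' a‖ ^ 2 + g p ≤ (1/2) * ‖v - a + f' a‖ ^ 2 + g v) :
    f p + g p + (1/2) * ‖u - p‖ ^ 2 ≤ f u + g u + (1/2) * ‖u - a‖ ^ 2 := by
  have h1 := aux_prox g hg V hV p (a - f' a) u hp hu (by
    intro v hv
    have := hmin v hv
    rwa [show p - (a - f' a) = p - a + f' a by abel, show v - (a - f' a) = v - a + f' a by abel])
  have h2 := aux_descent f f' hf' hl a (p - a)
  have h3 := aux_grad f f' hf hf' hl a (u - a)
  rw [add_sub_cancel] at h2 h3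
  have e : ‖u - a‖ ^ 2 = ‖u - p‖ ^ 2 + 2 * inner ℝ (u - p) (p - a) + ‖p - a‖ ^ 2 := by
    rw [← norm_add_sq_real]; congr 2; abel
  have e2 : inner ℝ (p - (a - f' a)) (u - p)
      = inner ℝ (u - p) (p - a) + inner ℝ (f' a) (u - a) - inner ℝ (f' a) (p - a) := by
    rw [show p - (a - f' a) = (p - a) + f' a by abel, inner_add_left,
      real_inner_comm (u - p) (p - a), show u - p = (u - a) - (p - a) by abel,
      inner_sub_right (f' a)]
    ring
  linarith

theorem aux_rec (a δ e : ℕ → ℝ) (ha : ∀ n, 0 ≤ a n) (hδ : ∀ n, 0 ≤ δ n) (he : ∀ n, 0 ≤ e n)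
    (h : ∀ n, a (n+1) ^ 2 ≤ (a n + δ n) ^ 2 + e n) (N : ℕ) :
    a N ≤ √(a 0 ^ 2 + ∑ i ∈ Finset.range N, e i) + ∑ i ∈ Finset.range N, δ i := by
  induction N with
  | zero => simp [Real.sqrt_sq (ha 0)]
  | succ n ih =>
    rw [Finset.sum_range_succ, Finset.sum_range_succ]
    set T := a 0 ^ 2 + ∑ i ∈ Finset.range n, e i with hT
    set S := ∑ i ∈ Finset.range n, δ i with hS
    have hT0 : 0 ≤ T := by
      have := Finset.sum_nonneg (s := Finset.range n) (fun i _ => he i); positivity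
    have hS0 : 0 ≤ S := Finset.sum_nonneg (fun i _ => hδ i)
    rw [← add_assoc (a 0 ^ 2), ← hT]
    have h1 := Real.sqrt_le_sqrt (show T ≤ T + e n by linarith [he n])
    have h2 := Real.sq_sqrt hT0
    have h3 := Real.sq_sqrt (show 0 ≤ T + e n by linarith [he n])
    have h4 := Real.sqrt_nonneg T
    have h5 := hδ n
    apply abs_le_of_sq_le_sq' _ (by positivity) |>.2
    have h6 : (a n + δ n) ^ 2 ≤ (√T + S + δ n) ^ 2 := by
      apply pow_le_pow_left₀ (by linarith [ha n]); linarith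
    have h7 := mul_le_mul_of_nonneg_right h1 (add_nonneg hS0 h5)
    nlinarith [h n]

/-- block index -/
def auxK (nk : ℕ → ℕ) : ℕ → ℕ
  | 0 => 0
  | n + 1 => if n + 1 = nk (auxK nk n + 1) then auxK nk n + 1 else auxK nk n

theorem auxK_spec (nk : ℕ → ℕ) (h0 : nk 0 = 0) (hm : StrictMono nk) (n : ℕ) :
    nk (auxK nk n) ≤ n ∧ n < nk (auxK nk n + 1) := by
  induction n with
  | zero => 
    have := hm (show 0 < 1 by simp)
    simp [auxK, h0]; omega
  | succ n ih =>
    rw [auxK]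
    split_ifs with h
    · have := hm (show auxK nk n + 1 < auxK nk n + 1 + 1 by simp)
      omega
    · omega

theorem auxK_delta (nk : ℕ → ℕ) (d : ℕ → ℕ → ℝ) (h0 : ∀ k, d k k = 0) (N : ℕ) :
    ∑ n ∈ Finset.range N, d (auxK nk n) (auxK nk (n+1))
      = ∑ j ∈ Finset.range (auxK nk N), d j (j+1) := by
  induction N with
  | zero => simp [auxK]
  | succ n ih =>
    rw [Finset.sum_range_succ, ih, auxK]
    split_ifs with h
    · rw [Finset.sum_range_succ]
    · simp [h0]

theorem auxK_sum (nk : ℕ → ℕ) (h0 : nk 0 = 0) (hm : StrictMono nk) (c : ℕ → ℝ)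
    (hc : ∀ k, 0 ≤ c k) (N : ℕ) :
    ∑ n ∈ Finset.range N, ((n:ℝ) + 1) * c (auxK nk (n + 1))
      ≤ ∑ j ∈ Finset.range (auxK nk N + 1), (nk (j+1) : ℝ) ^ 2 * c j := by
  have key : ∑ n ∈ Finset.range (N + 1), (n:ℝ) * c (auxK nk n)
      ≤ ∑ j ∈ Finset.range (auxK nk N), (nk (j+1) : ℝ) ^ 2 * c j 
        + ((N:ℝ)^2 + N) * c (auxK nk N) := by
    induction N with
    | zero => simp [auxK]
    | succ n ih =>
      rw [Finset.sum_range_succ]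
      refine (add_le_add_left ih _).trans ?_
      have hs := (auxK_spec nk h0 hm n).2
      rw [auxK]
      split_ifs with h
      · rw [Finset.sum_range_succ, ← h]
        push_cast
        have h1 := hc (auxK nk n)
        have h2 := hc (auxK nk n + 1)
        have : (0:ℝ) ≤ n := by positivity
        nlinarith [mul_nonneg this h1, mul_nonneg (sq_nonneg ((n:ℝ)+1)) h2]
      · push_cast
        have h1 := hc (auxK nk n)
        have : (0:ℝ) ≤ n := by positivity
        nlinarith [mul_nonneg this h1]
  have e : ∑ n ∈ Finset.range (N + 1), (n:ℝ) * c (auxK nk n)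
      = ∑ n ∈ Finset.range N, ((n:ℝ) + 1) * c (auxK nk (n + 1)) := by
    rw [Finset.sum_range_succ']; simp
  rw [← e]
  refine key.trans ?_
  rw [Finset.sum_range_succ _ (auxK nk N)]
  have hs := (auxK_spec nk h0 hm N).2
  have h1 : ((N:ℝ) + 1) ≤ nk (auxK nk N + 1) := by exact_mod_cast hs
  have h2 : (0:ℝ) ≤ N := by positivity
  have h3 : ((N:ℝ)^2 + N) ≤ (nk (auxK nk N + 1) : ℝ) ^ 2 := by nlinarith
  have := mul_le_mul_of_nonneg_right h3 (hc (auxK nk N))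
  linarith

/-- **Refinement without overfitting, case `a_U = 1`** (Lemma `sufficiently fast`):
if `‖z̃_k‖ ≤ C_U`, `E₀(z̃_k) ≤ C_E a_E^{−k}`, `Σ n_k² a_E^{−k} < ∞` and
`Σ ‖z̃_k − z̃_{k+1}‖ < ∞`, then there is `C' > 0` with `t_N² E₀(x_N) ≤ C'` for all `N ≥ 1`. -/
theorem stmt_5
    {H : Type*} [NormedAddCommGroup H] [InnerProductSpace ℝ H] [CompleteSpace H]
    (f g E E0 : H → ℝ) (f' : H → H) (m : ℝ)
    (hf_conv : ConvexOn ℝ Set.univ f)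
    (hg_conv : ConvexOn ℝ Set.univ g)
    (hf' : ∀ u, HasGradientAt f (f' u) u)
    (hf'_lip : LipschitzWith 1 f')
    (hE : ∀ u, E u = f u + g u)
    (hE_bdd : BddBelow (Set.range E))
    (hm : m = ⨅ u, E u)
    (hE0 : ∀ u, E0 u = E u - m)
    (t ρ : ℕ → ℝ)
    (ht0 : t 0 = 1) (ht1 : ∀ n, 1 ≤ t n)
    (hρ : ∀ n, ρ n = (t n) ^ 2 - (t (n + 1)) ^ 2 + t (n + 1))
    (hρ0 : ∀ n, 0 ≤ ρ n)
    (U : ℕ → Set H)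
    (hU_ne : ∀ n, (U n).Nonempty)
    (hU_closed : ∀ n, IsClosed (U n))
    (hU_conv : ∀ n, Convex ℝ (U n))
    (x y xbar : ℕ → H)
    (hx0 : x 0 = y 0) (hx0U : x 0 ∈ U 0)
    (hxbar : ∀ n, xbar n = (1 - 1 / t n) • x n + (1 / t n) • y n)
    (hxmem : ∀ n, x (n + 1) ∈ U (n + 1))
    (hxmin : ∀ n, ∀ u ∈ U (n + 1),
      (1/2) * ‖x (n + 1) - xbar n + f' (xbar n)‖ ^ 2 + g (x (n + 1)) ≤
        (1/2) * ‖u - xbar n + f' (xbar n)‖ ^ 2 + g u)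
    (hy : ∀ n, y (n + 1) = (1 - t n) • x n + t n • x (n + 1))
    (hxU : ∀ n, x n ∈ U (n + 1))
    (nk : ℕ → ℕ) (hnk0 : nk 0 = 0) (hnk_mono : StrictMono nk)
    (zt : ℕ → H)
    (hzt : ∀ k n : ℕ, nk k ≤ n → n < nk (k + 1) → zt k ∈ U n)
    (aE CU CE : ℝ)
    (haE : 1 ≤ aE) (hCU : 0 < CU) (hCE : 0 < CE)
    (hzt_norm : ∀ k : ℕ, ‖zt k‖ ≤ CU)
    (hzt_E : ∀ k : ℕ, E0 (zt k) ≤ CE * (aE ^ k)⁻¹)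
    (hsum_nk : Summable fun k : ℕ => ((nk k : ℝ)) ^ 2 * (aE ^ k)⁻¹)
    (hsum_zt : Summable fun k : ℕ => ‖zt k - zt (k + 1)‖) :
    ∃ C' > 0, ∀ N : ℕ, 1 ≤ N → (t N) ^ 2 * E0 (x N) ≤ C' := by
  have hE0nn : ∀ u, 0 ≤ E0 u := by
    intro u
    rw [hE0, hm]
    linarith [ciInf_le hE_bdd u]
  -- stepsizes
  have htstep : ∀ n, t (n+1) ≤ t n + 1 := by
    intro n
    have h1 := hρ0 n
    rw [hρ] at h1
    have h2 := ht1 n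
    have h3 := ht1 (n+1)
    by_contra hcon
    push Not at hcon
    nlinarith
  have htn : ∀ n : ℕ, t n ≤ (n:ℝ) + 1 := by
    intro n
    induction n with
    | zero => simp [ht0]
    | succ n ih => push_cast; linarith [htstep n]
  set K := auxK nk with hK
  set z : ℕ → H := fun n => zt (K n) with hz
  have hzU : ∀ n, z n ∈ U n := fun n =>
    hzt _ _ (auxK_spec nk hnk0 hnk_mono n).1 (auxK_spec nk hnk0 hnk_mono n).2
  have hstep : ∀ n, (t n) ^ 2 * E0 (x (n+1)) + (1/2) * ‖z (n+1) - y (n+1)‖ ^ 2 ≤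
      ((t n) ^ 2 - t n) * E0 (x n) + t n * E0 (z (n+1)) + (1/2) * ‖z (n+1) - y n‖ ^ 2 := by
    intro n
    have htp : 0 < t n := by linarith [ht1 n]
    have hti : 1 / t n ≤ 1 := by rw [div_le_one htp]; exact ht1 n
    have hti0 : 0 ≤ 1 / t n := by positivity
    set u := (1 - 1 / t n) • x n + (1 / t n) • z (n+1) with hu
    have huU : u ∈ U (n+1) := hU_conv (n+1) (hxU n) (hzU (n+1)) (by linarith) hti0 (by ring)
    have h := aux_step f g f' hf_conv hg_conv hf' hf'_lip (U (n+1)) (hU_conv _) (x (n+1))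
      (xbar n) u (hxmem n) huU (hxmin n)
    have hf1 := hf_conv.2 (Set.mem_univ (x n)) (Set.mem_univ (z (n+1)))
      (by linarith : 0 ≤ 1 - 1 / t n) hti0 (by ring)
    have hg1 := hg_conv.2 (Set.mem_univ (x n)) (Set.mem_univ (z (n+1)))
      (by linarith : 0 ≤ 1 - 1 / t n) hti0 (by ring)
    rw [← hu] at hf1 hg1
    simp only [smul_eq_mul] at hf1 hg1
    have e1 : z (n+1) - y (n+1) = t n • (u - x (n+1)) := by
      rw [hy, hu, smul_sub, smul_add, smul_smul, smul_smul, mul_sub, mul_one_div_cancel htp.ne']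
      module
    have e2 : z (n+1) - y n = t n • (u - xbar n) := by
      rw [hxbar, hu, add_sub_add_left_eq_sub, ← smul_sub, smul_smul, mul_one_div_cancel htp.ne', one_smul]
    rw [e1, e2, norm_smul, norm_smul, mul_pow, mul_pow, Real.norm_eq_abs, sq_abs, hE0, hE0, hE0,
      hE, hE, hE]
    have h5 : f (x (n+1)) + g (x (n+1)) + (1/2) * ‖u - x (n+1)‖ ^ 2 ≤
      (1 - 1 / t n) * (f (x n) + g (x n)) + (1 / t n) * (f (z (n+1)) + g (z (n+1))) 
        + (1/2) * ‖u - xbar n‖ ^ 2 := by linarith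
    have h6 := mul_le_mul_of_nonneg_left h5 (sq_nonneg (t n))
    have e3 : (t n) ^ 2 * ((1 - 1 / t n) * (f (x n) + g (x n))
        + (1 / t n) * (f (z (n+1)) + g (z (n+1))) + (1/2) * ‖u - xbar n‖ ^ 2)
        = ((t n) ^ 2 - t n) * (f (x n) + g (x n)) + t n * (f (z (n+1)) + g (z (n+1)))
          + (t n) ^ 2 * ((1/2) * ‖u - xbar n‖ ^ 2) := by
      field_simp
    rw [e3] at h6
    linarith
  -- Lyapunov quantity
  have hv0 : ∀ n, 0 ≤ (t n)^2 - t n := fun n => by nlinarith [ht1 n]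
  have hv : ∀ n, (t (n+1))^2 - t (n+1) ≤ (t n)^2 := fun n => by
    have := hρ0 n
    rw [hρ] at this
    linarith
  set a2 : ℕ → ℝ := fun n => 2 * (((t n)^2 - t n) * E0 (x n)) + ‖z n - y n‖ ^ 2 with ha2
  have ha20 : ∀ n, 0 ≤ a2 n := fun n => by
    have := mul_nonneg (hv0 n) (hE0nn (x n))
    simp only [ha2]; positivity
  set δ : ℕ → ℝ := fun n => ‖z n - z (n+1)‖ with hδ
  set c : ℕ → ℝ := fun k => CE * (aE ^ k)⁻¹ with hc
  have hc0 : ∀ k, 0 ≤ c k := fun k => by simp only [hc]; positivity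
  set e : ℕ → ℝ := fun n => 2 * (((n:ℝ) + 1) * c (K (n+1))) with he
  have he0 : ∀ n, 0 ≤ e n := fun n => by have := hc0 (K (n+1)); simp only [he]; positivity
  have hmain : ∀ n, 2 * ((t n)^2 * E0 (x (n+1))) + ‖z (n+1) - y (n+1)‖ ^ 2
      ≤ (√(a2 n) + δ n) ^ 2 + e n := by
    intro n
    have h1 := hstep n
    have h2 : t n * E0 (z (n+1)) ≤ ((n:ℝ) + 1) * c (K (n+1)) :=
      mul_le_mul (htn n) (hzt_E _) (hE0nn _) (by positivity)
    have h3 : ‖z (n+1) - y n‖ ≤ ‖z n - y n‖ + δ n := by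
      have := norm_sub_le_norm_sub_add_norm_sub (z (n+1)) (z n) (y n)
      rw [norm_sub_rev (z (n+1)) (z n)] at this
      linarith
    have h4 : ‖z n - y n‖ ≤ √(a2 n) := by
      apply Real.le_sqrt_of_sq_le
      have := mul_nonneg (hv0 n) (hE0nn (x n))
      simp only [ha2]; linarith
    have h5 := Real.sq_sqrt (ha20 n)
    have h6 : ‖z (n+1) - y n‖ ^ 2 ≤ (‖z n - y n‖ + δ n) ^ 2 :=
      pow_le_pow_left₀ (norm_nonneg _) h3 2
    have hδ0 : 0 ≤ δ n := norm_nonneg _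
    have h7 := mul_le_mul_of_nonneg_right h4 hδ0
    have h8 : a2 n = 2 * (((t n)^2 - t n) * E0 (x n)) + ‖z n - y n‖ ^ 2 := rfl
    have h9 : e n = 2 * (((n:ℝ) + 1) * c (K (n+1))) := rfl
    nlinarith
  have hrec := aux_rec (fun n => √(a2 n)) δ e (fun n => Real.sqrt_nonneg _)
    (fun n => norm_nonneg _) he0 (by
      intro n
      show √(a2 (n+1)) ^ 2 ≤ (√(a2 n) + δ n) ^ 2 + e n
      rw [Real.sq_sqrt (ha20 (n+1))]
      refine le_trans ?_ (hmain n)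
      have := mul_le_mul_of_nonneg_right (hv n) (hE0nn (x (n+1)))
      simp only [ha2]
      linarith)
  -- bounds on sums
  obtain ⟨D, hD⟩ : ∃ D, ∀ N, ∑ i ∈ Finset.range N, δ i ≤ D := by
    refine ⟨∑' k : ℕ, ‖zt k - zt (k + 1)‖, fun N => ?_⟩
    have h := auxK_delta nk (fun i j => ‖zt i - zt j‖) (by simp) N
    refine (le_of_eq h).trans (hsum_zt.sum_le_tsum _ (fun i _ => norm_nonneg _))
  have hS2 : Summable fun k : ℕ => ((nk (k+1) : ℝ)) ^ 2 * c k := by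
    have h1 := ((summable_nat_add_iff 1).2 hsum_nk).mul_left (CE * aE)
    refine h1.congr fun k => ?_
    have : aE ≠ 0 := by linarith
    simp only [hc]
    rw [pow_succ]
    field_simp
    try ring
  obtain ⟨G, hG⟩ : ∃ G, ∀ N, ∑ i ∈ Finset.range N, e i ≤ G := by
    refine ⟨2 * ∑' k : ℕ, ((nk (k+1) : ℝ)) ^ 2 * c k, fun N => ?_⟩
    simp only [he]
    rw [← Finset.mul_sum]
    refine mul_le_mul_of_nonneg_left ?_ (by norm_num)
    exact (auxK_sum nk hnk0 hnk_mono c hc0 N).trans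
      (hS2.sum_le_tsum _ (fun i _ => mul_nonneg (sq_nonneg _) (hc0 i)))
  set R := √(√(a2 0) ^ 2 + G) + D with hR
  have haR : ∀ n, √(a2 n) + δ n ≤ R := by
    intro n
    have h2 := hrec n
    have h3 := hD (n+1)
    rw [Finset.sum_range_succ] at h3
    have h4 := Real.sqrt_le_sqrt (show √(a2 0) ^ 2 + ∑ i ∈ Finset.range n, e i
      ≤ √(a2 0) ^ 2 + G by linarith [hG n])
    linarith
  have heG : ∀ n, e n ≤ G := fun n => by
    have h1 := hG (n+1)
    rw [Finset.sum_range_succ] at h1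
    linarith [Finset.sum_nonneg (s := Finset.range n) (fun i _ => he0 i)]
  have hG0 : 0 ≤ G := (he0 0).trans (heG 0)
  refine ⟨2 * (R ^ 2 + G) + 1, by positivity, fun N hN => ?_⟩
  obtain ⟨n, rfl⟩ : ∃ n, N = n + 1 := ⟨N - 1, by omega⟩
  have h1 := hmain n
  have h2 : (√(a2 n) + δ n) ^ 2 ≤ R ^ 2 :=
    pow_le_pow_left₀ (add_nonneg (Real.sqrt_nonneg _) (norm_nonneg _)) (haR n) 2
  have h3 : (t (n+1)) ^ 2 ≤ 4 * (t n) ^ 2 := by nlinarith [htstep n, ht1 n, ht1 (n+1)]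
  have h4 := mul_le_mul_of_nonneg_right h3 (hE0nn (x (n+1)))
  have h5 := heG n
  nlinarith [sq_nonneg ‖z (n+1) - y (n+1)‖]
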